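/- Every closed, infinite-dimensional subspace of ℓ_p (1 ≤ p < ∞) or of c₀ contains, for each ε > 0, a closed subspace F and an isomorphism U : E → F (E being ℓ_p resp. c₀) satisfying (1 − ε)‖x‖ ≤ ‖Ux‖ ≤ ‖x‖ for all x ∈ E; i.e., every closed infinite-dimensional subspace of E contains almost isometric copies of E. -/

import Mathlib

open scoped ENNReal ZeroAtInfty

section abstractPart
open Filter Topology

variable {𝕜 : Type*} [RCLike 𝕜] {E : Type*} [NormedAddCommGroup E] [NormedSpace 𝕜 E]
  [CompleteSpace E]

/-- Abstract data: a coordinate system with norm determined on disjoint supports. -/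
structure CoordSys (c : ℕ → E →ₗ[𝕜] 𝕜) (e : ℕ → E) (φ : ℝ → ℝ → ℝ) : Prop where
  ce : ∀ i j, i ≠ j → c i (e j) = 0
  ne : ∀ i, ‖e i‖ = 1
  bd : ∀ i x, ‖c i x‖ ≤ ‖x‖
  hs : ∀ x, HasSum (fun i => c i x • e i) x
  dj : ∀ x y, (∀ i, c i x = 0 ∨ c i y = 0) → ‖x + y‖ = φ ‖x‖ ‖y‖

variable {c : ℕ → E →ₗ[𝕜] 𝕜} {e : ℕ → E} {φ : ℝ → ℝ → ℝ}

theorem CoordSys.exists_zero (F : Submodule 𝕜 E) (hF : ¬ FiniteDimensional 𝕜 F) (c : ℕ → E →ₗ[𝕜] 𝕜)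
    (N : ℕ) : ∃ x ∈ F, x ≠ 0 ∧ ∀ i < N, c i x = 0 := by
  by_contra! h
  apply hF
  let f : F →ₗ[𝕜] (Fin N → 𝕜) := LinearMap.pi (fun i => (c i).comp F.subtype)
  have hf : Function.Injective f := by
    rw [injective_iff_map_eq_zero]
    intro x hx
    by_contra hne
    obtain ⟨i, hi, hci⟩ := h x x.2 (by simpa using hne)
    exact hci (congrFun hx ⟨i, hi⟩)
  exact FiniteDimensional.of_injective f hf

theorem CoordSys.c_sum (h : CoordSys c e φ) (s : Finset ℕ) (a : ℕ → 𝕜) (j : ℕ) (hj : j ∉ s) :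
    c j (∑ i ∈ s, a i • e i) = 0 := by
  rw [map_sum]
  apply Finset.sum_eq_zero
  intro i hi
  rw [map_smul, h.ce j i (by rintro rfl; exact hj hi), smul_zero]

theorem CoordSys.ce_self (h : CoordSys c e φ) (i : ℕ) : c i (e i) = 1 := by
  have h1 := h.hs (e i)
  have h2 : HasSum (fun j => c j (e i) • e j) (c i (e i) • e i) := by
    convert hasSum_single i (f := fun j => c j (e i) • e j) ?_ using 1
    intro j hj
    simp [h.ce j i hj]
  have h3 := h1.unique h2
  have hne : e i ≠ 0 := by
    intro h0
    have := h.ne i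
    simp [h0] at this
  have : (1 - c i (e i)) • e i = 0 := by
    rw [sub_smul, one_smul, ← h3, sub_self]
  rcases smul_eq_zero.1 this with h4 | h4
  · exact (sub_eq_zero.1 h4).symm
  · exact absurd h4 hne

/-- One step of the gliding hump. -/
theorem CoordSys.step (h : CoordSys c e φ) (F : Submodule 𝕜 E) (hF : ¬ FiniteDimensional 𝕜 F)
    (N : ℕ) (δ : ℝ) (hδ : 0 < δ) :
    ∃ (M : ℕ) (x u : E), N < M ∧ x ∈ F ∧ ‖u‖ = 1 ∧ ‖x - u‖ ≤ δ ∧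
      ∀ i, c i u ≠ 0 → N ≤ i ∧ i < M := by
  obtain ⟨x, hxF, hx0, hxN⟩ := CoordSys.exists_zero F hF c N
  have hnx : 0 < ‖x‖ := norm_pos_iff.2 hx0
  have ht := (h.hs x).tendsto_sum_nat
  have h1 : Tendsto (fun n => ‖x - ∑ i ∈ Finset.range n, c i x • e i‖) atTop (𝓝 0) := by
    simpa using (tendsto_const_nhds (x := x)).sub ht |>.norm
  have h2 : Tendsto (fun n => δ * ‖∑ i ∈ Finset.range n, c i x • e i‖) atTop (𝓝 (δ * ‖x‖)) :=
    ht.norm.const_mul δ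
  have h3 := h1.eventually_lt h2 (by positivity)
  have h4 := ht.norm.eventually_const_lt hnx
  obtain ⟨M, ⟨h3, h4⟩, hM⟩ := ((h3.and h4).and (eventually_gt_atTop N)).exists
  set y := ∑ i ∈ Finset.range M, c i x • e i with hy
  refine ⟨M, ((‖y‖⁻¹ : ℝ) : 𝕜) • x, ((‖y‖⁻¹ : ℝ) : 𝕜) • y, hM, F.smul_mem _ hxF, ?_, ?_, ?_⟩
  · rw [norm_smul, RCLike.norm_ofReal, abs_of_pos (by positivity), inv_mul_cancel₀ h4.ne']
  · rw [← smul_sub, norm_smul, RCLike.norm_ofReal, abs_of_pos (by positivity),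
      inv_mul_le_iff₀ h4, mul_comm]
    exact h3.le
  · intro i hi
    rw [map_smul] at hi
    have hi' : c i y ≠ 0 := fun h0 => hi (by rw [h0, smul_zero])
    have hiM : i < M := by
      by_contra hn
      exact hi' (h.c_sum _ _ i (by simpa using hn))
    refine ⟨?_, hiM⟩
    by_contra hn
    apply hi'
    rw [hy, map_sum]
    apply Finset.sum_eq_zero
    intro j hj
    by_cases hij : i = j
    · subst hij
      rw [hxN i (by omega), zero_smul, map_zero]
    · rw [map_smul, h.ce i j hij, smul_zero]

theorem CoordSys.seq (h : CoordSys c e φ) (F : Submodule 𝕜 E) (hF : ¬ FiniteDimensional 𝕜 F)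
    (δ : ℕ → ℝ) (hδ : ∀ n, 0 < δ n) :
    ∃ (x u : ℕ → E), (∀ n, x n ∈ F) ∧ (∀ n, ‖u n‖ = 1) ∧ (∀ n, ‖x n - u n‖ ≤ δ n) ∧
      ∀ m n, m ≠ n → ∀ i, c i (u m) = 0 ∨ c i (u n) = 0 := by
  choose M x u hM hx hu hxu hc using fun (N n : ℕ) => h.step F hF N (δ n) (hδ n)
  let N : ℕ → ℕ := fun n => Nat.rec 0 (fun n k => M k n) n
  have hN : ∀ n, N (n + 1) = M (N n) n := fun n => rfl
  have hmono : Monotone N := monotone_nat_of_le_succ (fun n => by rw [hN]; exact (hM _ _).le)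
  refine ⟨fun n => x (N n) n, fun n => u (N n) n, fun n => hx _ _, fun n => hu _ _,
    fun n => hxu _ _, ?_⟩
  have key : ∀ m n, m < n → ∀ i, c i (u (N m) m) = 0 ∨ c i (u (N n) n) = 0 := by
    intro m n hmn i
    by_contra! hcon
    have h1 := (hc _ _ i hcon.1).2
    have h2 := (hc _ _ i hcon.2).1
    have h3 : N (m + 1) ≤ N n := hmono hmn
    rw [hN] at h3
    omega
  intro m n hmn i
  rcases lt_or_gt_of_ne hmn with hlt | hlt
  · exact key m n hlt i
  · exact (key n m hlt i).symm

theorem CoordSys.norm_block (h : CoordSys c e φ) (u : ℕ → E) (hu : ∀ n, ‖u n‖ = 1)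
    (hd : ∀ m n, m ≠ n → ∀ i, c i (u m) = 0 ∨ c i (u n) = 0) (a : ℕ → 𝕜) (s : Finset ℕ) :
    ‖∑ i ∈ s, a i • u i‖ = ‖∑ i ∈ s, a i • e i‖ := by
  classical
  induction s using Finset.induction_on with
  | empty => simp
  | insert k s hk ih =>
    rw [Finset.sum_insert hk, Finset.sum_insert hk, h.dj, h.dj, ih, norm_smul, norm_smul, hu, h.ne]
    · intro i
      by_cases hik : i = k
      · subst hik
        exact Or.inr (h.c_sum s a i hk)
      · left
        rw [map_smul, h.ce i k hik, smul_zero]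
    · intro i
      by_cases hi : c i (u k) = 0
      · left; rw [map_smul, hi, smul_zero]
      · right
        rw [map_sum]
        apply Finset.sum_eq_zero
        intro j hj
        have hjk : k ≠ j := by rintro rfl; exact hk hj
        rw [map_smul, (hd k j hjk i).resolve_left hi, smul_zero]

theorem CoordSys.main (h : CoordSys c e φ) (F : Submodule 𝕜 E) (hcl : IsClosed (F : Set E))
    (hF : ¬ FiniteDimensional 𝕜 F) (ε : ℝ) (hε : 0 < ε) :
    ∃ G : Submodule 𝕜 E, G ≤ F ∧ IsClosed (G : Set E) ∧
      ∃ U : E →ₗ[𝕜] G, Function.Surjective U ∧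
        ∀ x, (1 - ε) * ‖x‖ ≤ ‖U x‖ ∧ ‖U x‖ ≤ ‖x‖ := by
  obtain ⟨δ, hδ, hδ1, hδε⟩ : ∃ δ : ℝ, 0 < δ ∧ δ < 1 ∧ 2 * δ ≤ ε := by
    refine ⟨min (1/2) (ε/2), by positivity, ?_, ?_⟩
    · exact (min_le_left _ _).trans_lt (by norm_num)
    · linarith [min_le_right (1/2) (ε/2)]
  have hg : HasSum (fun n : ℕ => δ / 2 / 2 ^ n) δ := hasSum_geometric_two' δ
  obtain ⟨x, u, hxF, hu, hxu, hd⟩ := h.seq F hF (fun n : ℕ => δ / 2 / 2 ^ n)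
    (fun n => by positivity)
  have nb := h.norm_block u hu hd
  have sW : ∀ z, Summable (fun i => c i z • u i) := by
    intro z
    have hs := (h.hs z).summable
    rw [summable_iff_vanishing_norm] at hs ⊢
    intro η hη
    obtain ⟨s, hs⟩ := hs η hη
    refine ⟨s, fun t ht => ?_⟩
    rw [nb (fun i => c i z)]
    exact hs t ht
  have nW : ∀ z, ‖∑' i, c i z • u i‖ = ‖z‖ := by
    intro z
    have h1 := (sW z).hasSum.tendsto_sum_nat.norm
    have h2 := (h.hs z).tendsto_sum_nat.norm
    refine tendsto_nhds_unique h1 (h2.congr fun n => ?_)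
    rw [nb (fun i => c i z)]
  have bR : ∀ z i, ‖c i z • (x i - u i)‖ ≤ ‖z‖ * (δ / 2 / 2 ^ i) := by
    intro z i
    rw [norm_smul]
    exact mul_le_mul (h.bd i z) (hxu i) (norm_nonneg _) (norm_nonneg _)
  have sR : ∀ z, Summable (fun i => c i z • (x i - u i)) := fun z =>
    Summable.of_norm_bounded (hg.summable.mul_left ‖z‖) (bR z)
  have nR : ∀ z, ‖∑' i, c i z • (x i - u i)‖ ≤ ‖z‖ * δ := fun z =>
    tsum_of_norm_bounded (hg.mul_left ‖z‖) (bR z)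
  have hV : ∀ z, HasSum (fun i => c i z • x i)
      ((∑' i, c i z • u i) + ∑' i, c i z • (x i - u i)) := by
    intro z
    refine ((sW z).hasSum.add (sR z).hasSum).congr_fun ?_ 
    intro i
    rw [← smul_add, add_sub_cancel]
  let V : E →ₗ[𝕜] E :=
    { toFun := fun z => ∑' i, c i z • x i
      map_add' := fun y z => by
        simp only [map_add, add_smul]
        exact (hV y).summable.tsum_add (hV z).summable
      map_smul' := fun a z => by
        simp only [map_smul, smul_eq_mul, mul_smul, RingHom.id_apply]
        exact (hV z).summable.tsum_const_smul a }
  have hVz : ∀ z, V z = (∑' i, c i z • u i) + ∑' i, c i z • (x i - u i) := fun z => (hV z).tsum_eq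
  have hVF : ∀ z, V z ∈ F := by
    intro z
    refine hcl.mem_of_tendsto (hV z).summable.hasSum (Eventually.of_forall fun s => ?_)
    exact F.sum_mem fun i _ => F.smul_mem _ (hxF i)
  have up : ∀ z, ‖V z‖ ≤ (1 + δ) * ‖z‖ := by
    intro z
    rw [hVz]
    have := norm_add_le (∑' i, c i z • u i) (∑' i, c i z • (x i - u i))
    linarith [nW z, nR z]
  have lo : ∀ z, (1 - δ) * ‖z‖ ≤ ‖V z‖ := by
    intro z
    rw [hVz]
    have := norm_sub_le_norm_add (∑' i, c i z • u i) (∑' i, c i z • (x i - u i))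
    linarith [nW z, nR z]
  let T : E →ₗ[𝕜] E := (((1 + δ)⁻¹ : ℝ) : 𝕜) • V
  have hT : ∀ z, ‖T z‖ = (1 + δ)⁻¹ * ‖V z‖ := by
    intro z
    change ‖(((1 + δ)⁻¹ : ℝ) : 𝕜) • V z‖ = _
    rw [norm_smul, RCLike.norm_ofReal, abs_of_pos (by positivity)]
  have hTup : ∀ z, ‖T z‖ ≤ ‖z‖ := by
    intro z
    rw [hT, inv_mul_le_iff₀ (by positivity)]
    exact up z
  have hTlo0 : ∀ z, ((1 - δ) / (1 + δ)) * ‖z‖ ≤ ‖T z‖ := by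
    intro z
    rw [hT, div_eq_inv_mul, mul_assoc]
    exact mul_le_mul_of_nonneg_left (lo z) (by positivity)
  have hq : 1 - ε ≤ (1 - δ) / (1 + δ) := by
    rw [le_div_iff₀ (by positivity)]
    nlinarith
  have hq0 : 0 < (1 - δ) / (1 + δ) := div_pos (by linarith) (by linarith)
  let T' : E →L[𝕜] E := T.mkContinuous 1 (fun z => by simpa using hTup z)
  have hanti : AntilipschitzWith (Real.toNNReal ((1 - δ) / (1 + δ))⁻¹) T' := by
    refine AddMonoidHomClass.antilipschitz_of_bound T' fun z => ?_
    rw [Real.coe_toNNReal _ (by positivity), le_inv_mul_iff₀ hq0]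
    exact hTlo0 z
  refine ⟨LinearMap.range T, ?_, ?_, T.rangeRestrict, T.surjective_rangeRestrict, ?_⟩
  · rintro _ ⟨z, rfl⟩
    exact F.smul_mem _ (hVF z)
  · have := hanti.isClosed_range T'.uniformContinuous
    exact this
  · intro z
    refine ⟨?_, hTup z⟩
    exact (mul_le_mul_of_nonneg_right hq (norm_nonneg z)).trans (hTlo0 z)

end abstractPart

section concrete
open Filter Topology

variable {𝕜 : Type*} [RCLike 𝕜]

theorem lp_coordSys (p : ℝ≥0∞) [Fact (1 ≤ p)] (hp : p ≠ ∞) :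
    CoordSys (𝕜 := 𝕜) (E := lp (fun _ : ℕ => 𝕜) p)
      (fun i => { toFun := fun x => x i, map_add' := fun _ _ => rfl, map_smul' := fun _ _ => rfl })
      (fun i => lp.single p i (1 : 𝕜))
      (fun a b => (a ^ p.toReal + b ^ p.toReal) ^ (1 / p.toReal)) := by
  have hp1 : 1 ≤ p := Fact.out
  have hp0 : p ≠ 0 := (zero_lt_one.trans_le hp1).ne'
  have hpp : 0 < p.toReal := ENNReal.toReal_pos hp0 hp
  refine ⟨?_, ?_, ?_, ?_, ?_⟩
  · intro i j hij
    change (lp.single p j (1 : 𝕜) : lp (fun _ : ℕ => 𝕜) p) i = 0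
    simp [lp.single_apply, hij]
  · intro i
    rw [lp.norm_single (pos_iff_ne_zero.2 hp0)]
    simp
  · intro i x
    exact lp.norm_apply_le_norm hp0 x i
  · intro x
    convert lp.hasSum_single hp x using 2 with i
    ext j
    by_cases hij : j = i
    · subst hij; simp [lp.single_apply]; rfl
    · simp [lp.single_apply, hij]
  · intro x y hxy
    have hx := lp.hasSum_norm hpp x
    have hy := lp.hasSum_norm hpp y
    have hz := lp.hasSum_norm hpp (x + y)
    have : HasSum (fun i => ‖(x + y) i‖ ^ p.toReal) (‖x‖ ^ p.toReal + ‖y‖ ^ p.toReal) := by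
      refine (hx.add hy).congr_fun ?_
      intro i
      have h1 : x i = 0 ∨ y i = 0 := hxy i
      rcases h1 with h1 | h1 <;> simp [h1, Real.zero_rpow hpp.ne']
    have h2 := hz.unique this
    rw [← h2, ← Real.rpow_mul (norm_nonneg _), mul_one_div_cancel hpp.ne', Real.rpow_one]

theorem c0_norm_le {x : C₀(ℕ, 𝕜)} {C : ℝ} (hC : 0 ≤ C) : ‖x‖ ≤ C ↔ ∀ i, ‖x i‖ ≤ C :=
  BoundedContinuousFunction.norm_le (f := x.toBCF) hC

theorem c0_apply_le (x : C₀(ℕ, 𝕜)) (i : ℕ) : ‖x i‖ ≤ ‖x‖ :=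
  x.toBCF.norm_coe_le_norm i

/-- unit vectors of c0 -/
noncomputable def c0single (i : ℕ) : C₀(ℕ, 𝕜) where
  toFun := fun j => if j = i then 1 else 0
  continuous_toFun := continuous_of_discreteTopology
  zero_at_infty' := by
    rw [cocompact_eq_cofinite]
    refine tendsto_const_nhds.congr' ?_
    have : ∀ᶠ j in cofinite, j ≠ i := by
      simp [eventually_cofinite]
    filter_upwards [this] with j hj
    simp [hj]

theorem c0single_apply (i j : ℕ) : (c0single i : C₀(ℕ, 𝕜)) j = if j = i then 1 else 0 := rfl

theorem c0_coordSys :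
    CoordSys (𝕜 := 𝕜) (E := C₀(ℕ, 𝕜))
      (fun i => { toFun := fun x => x i, map_add' := fun _ _ => rfl, map_smul' := fun _ _ => rfl })
      (fun i => c0single i) max := by
  refine ⟨?_, ?_, ?_, ?_, ?_⟩
  · intro i j hij
    simp [c0single_apply, hij]
  · intro i
    apply le_antisymm
    · rw [c0_norm_le zero_le_one]
      intro j
      rw [c0single_apply]
      split_ifs <;> simp
    · have := c0_apply_le (c0single i : C₀(ℕ, 𝕜)) i
      simpa [c0single_apply] using this
  · intro i x
    exact c0_apply_le x i
  · intro x
    have hx : Tendsto (fun i => ‖x i‖) cofinite (𝓝 0) := by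
      have := x.zero_at_infty'
      rw [cocompact_eq_cofinite] at this
      simpa using this.norm
    rw [HasSum, SummationFilter.unconditional_filter, Metric.tendsto_atTop]
    intro η hη
    have hfin : {i | ¬ ‖x i‖ < η / 2}.Finite := hx.eventually_lt_const (half_pos hη)
    refine ⟨hfin.toFinset, fun t ht => ?_⟩
    rw [dist_eq_norm]
    refine lt_of_le_of_lt ((c0_norm_le (half_pos hη).le).2 fun j => ?_) (half_lt_self hη)
    have hsum : (∑ i ∈ t, x i • c0single (𝕜 := 𝕜) i) j = if j ∈ t then x j else 0 := by
      have : ∀ f : ℕ → C₀(ℕ, 𝕜), (∑ i ∈ t, f i) j = ∑ i ∈ t, f i j := by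
        intro f
        exact map_sum ({ toFun := fun x => x j, map_add' := fun _ _ => rfl, map_zero' := rfl } :
          C₀(ℕ, 𝕜) →+ 𝕜) f t
      rw [this]
      simp [c0single_apply]
    change ‖(∑ i ∈ t, x i • c0single (𝕜 := 𝕜) i) j - x j‖ ≤ _
    rw [hsum]
    split_ifs with hj
    · simpa using (half_pos hη).le
    · have : j ∉ hfin.toFinset := fun h => hj (ht h)
      simp only [Set.Finite.mem_toFinset, Set.mem_ofPred_eq, not_not] at this
      simpa using this.le
  · intro x y hxy
    have hxy' : ∀ i, x i = 0 ∨ y i = 0 := hxy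
    apply le_antisymm
    · rw [c0_norm_le (le_max_of_le_left (norm_nonneg _))]
      intro i
      rw [ZeroAtInftyContinuousMap.add_apply]
      rcases hxy' i with h1 | h1
      · rw [h1, zero_add]; exact le_max_of_le_right (c0_apply_le y i)
      · rw [h1, add_zero]; exact le_max_of_le_left (c0_apply_le x i)
    · refine max_le ((c0_norm_le (norm_nonneg _)).2 fun i => ?_)
        ((c0_norm_le (norm_nonneg _)).2 fun i => ?_)
      · rcases hxy' i with h1 | h1
        · simp [h1]
        · have := c0_apply_le (x + y) i
          rwa [ZeroAtInftyContinuousMap.add_apply, h1, add_zero] at this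
      · rcases hxy' i with h1 | h1
        · have := c0_apply_le (x + y) i
          rwa [ZeroAtInftyContinuousMap.add_apply, h1, zero_add] at this
        · simp [h1]

end concrete

/-- Every closed infinite-dimensional subspace of `ℓ_p` (`1 ≤ p < ∞`) or of
`c₀` contains, for each `ε > 0`, a closed subspace `G` and a surjective linear map
`U : E → G` with `(1 - ε) ‖x‖ ≤ ‖U x‖ ≤ ‖x‖` for all `x`; i.e. every closed
infinite-dimensional subspace contains almost isometric copies of the whole space. -/
theorem almost_isometric_copies {𝕜 : Type*} [RCLike 𝕜] :
    (∀ (p : ℝ≥0∞) (_ : Fact (1 ≤ p)), p ≠ ∞ →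
      ∀ F : Submodule 𝕜 (lp (fun _ : ℕ => 𝕜) p), IsClosed (F : Set (lp (fun _ : ℕ => 𝕜) p)) →
        ¬ FiniteDimensional 𝕜 F → ∀ ε : ℝ, 0 < ε →
          ∃ G : Submodule 𝕜 (lp (fun _ : ℕ => 𝕜) p), G ≤ F ∧
            IsClosed (G : Set (lp (fun _ : ℕ => 𝕜) p)) ∧
            ∃ U : lp (fun _ : ℕ => 𝕜) p →ₗ[𝕜] G, Function.Surjective U ∧
              ∀ x, (1 - ε) * ‖x‖ ≤ ‖U x‖ ∧ ‖U x‖ ≤ ‖x‖) ∧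
    (∀ F : Submodule 𝕜 C₀(ℕ, 𝕜), IsClosed (F : Set C₀(ℕ, 𝕜)) →
      ¬ FiniteDimensional 𝕜 F → ∀ ε : ℝ, 0 < ε →
        ∃ G : Submodule 𝕜 C₀(ℕ, 𝕜), G ≤ F ∧ IsClosed (G : Set C₀(ℕ, 𝕜)) ∧
          ∃ U : C₀(ℕ, 𝕜) →ₗ[𝕜] G, Function.Surjective U ∧
            ∀ x, (1 - ε) * ‖x‖ ≤ ‖U x‖ ∧ ‖U x‖ ≤ ‖x‖) := by
  refine ⟨?_, ?_⟩
  · intro p hp hpt F hcl hF ε hε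
    exact (lp_coordSys p hpt).main F hcl hF ε hε
  · intro F hcl hF ε hε
    exact c0_coordSys.main F hcl hF ε hε
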